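/- arXiv:1106.0812 — 3 statements merged into one kernel-verified Lean document; each statement's English description precedes it below -/
import Mathlib

section
/- Let Φ and Ψ be continuously differentiable complex-valued functions on [0,l] with Φ(0) = 0 and Ψ(0) = 0. Define S ∈ B(L²(0,l)) by (Sf)(x) = -(1/2) ∫₀ˡ [∫_{|x-t|}^{x+t} Φ'((ξ+x-t)/2) Ψ'((ξ+t-x)/2) dξ] f(t) dt. Then A S - S A* is the rank-one operator f ↦ i Φ(x) ∫₀ˡ Ψ(t) f(t) dt, where (Af)(x) = -i ∫₀ˣ f(t) dt. -/
open MeasureTheory Set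

noncomputable section

lemma s4_ext (l : ℝ) (hl : 0 < l) (Φ : ℝ → ℂ) (hΦ : ContDiffOn ℝ 1 Φ (Icc (0:ℝ) l)) (hΦ0 : Φ 0 = 0) :
    ∃ g : ℝ → ℂ, Continuous g ∧ (∀ u ∈ Icc (0:ℝ) l, derivWithin Φ (Icc (0:ℝ) l) u = g u) ∧
      ∀ u ∈ Icc (0:ℝ) l, Φ u = ∫ s in (0:ℝ)..u, g s := by
  have hc : ContinuousOn (derivWithin Φ (Icc (0:ℝ) l)) (Icc (0:ℝ) l) :=
    hΦ.continuousOn_derivWithin (uniqueDiffOn_Icc hl) le_rfl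
  refine ⟨IccExtend hl.le ((Icc (0:ℝ) l).domRestrict (derivWithin Φ (Icc (0:ℝ) l))),
    (continuousOn_iff_continuous_domRestrict.1 hc).Icc_extend', ?_, ?_⟩
  · intro u hu
    rw [IccExtend_of_mem _ _ hu]; rfl
  · intro u hu
    have h1 : ∫ s in (0:ℝ)..u, derivWithin Φ (Icc (0:ℝ) l) s = Φ u - Φ 0 := by
      apply intervalIntegral.integral_eq_sub_of_hasDerivAt_of_le hu.1
      · exact hΦ.continuousOn.mono (Icc_subset_Icc_right hu.2)
      · intro x hx
        have hx' : x ∈ Icc (0:ℝ) l := ⟨hx.1.le, hx.2.le.trans hu.2⟩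
        exact ((hΦ.differentiableOn one_ne_zero) x hx').hasDerivWithinAt.hasDerivAt
          (Icc_mem_nhds hx.1 (hx.2.trans_le hu.2))
      · apply ContinuousOn.intervalIntegrable
        rw [uIcc_of_le hu.1]
        exact hc.mono (Icc_subset_Icc_right hu.2)
    rw [hΦ0, sub_zero] at h1
    rw [← h1]
    apply intervalIntegral.integral_congr
    intro s hs
    rw [uIcc_of_le hu.1] at hs
    have hs' : s ∈ Icc (0:ℝ) l := ⟨hs.1, hs.2.trans hu.2⟩
    rw [IccExtend_of_mem _ _ hs']; rfl

lemma s4_tri (a b : ℝ) (W : ℝ → ℝ → ℂ)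
    (hW : Integrable (Function.uncurry W)
      ((volume.restrict (Ioo (0:ℝ) b)).prod (volume.restrict (Ioo (0:ℝ) a)))) :
    ∫ r in Ioo (0:ℝ) b, ∫ s in Ioo (0:ℝ) a ∩ Ioi r, W r s =
      ∫ s in Ioo (0:ℝ) a, ∫ r in Ioo (0:ℝ) b ∩ Iio s, W r s := by
  have hm : MeasurableSet {p : ℝ × ℝ | p.1 < p.2} := measurableSet_lt measurable_fst measurable_snd
  have h2 := hW.indicator hm
  have h3 := integral_integral_swap (f := fun r s => indicator {p : ℝ × ℝ | p.1 < p.2} (Function.uncurry W) (r, s)) h2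
  have e1 : ∀ r, ∫ s in Ioo (0:ℝ) a ∩ Ioi r, W r s =
      ∫ s in Ioo (0:ℝ) a, indicator {p : ℝ × ℝ | p.1 < p.2} (Function.uncurry W) (r, s) := by
    intro r
    rw [inter_comm, ← Measure.restrict_restrict measurableSet_Ioi,
      ← integral_indicator measurableSet_Ioi]
    congr 1
  have e2 : ∀ s, ∫ r in Ioo (0:ℝ) b ∩ Iio s, W r s =
      ∫ r in Ioo (0:ℝ) b, indicator {p : ℝ × ℝ | p.1 < p.2} (Function.uncurry W) (r, s) := by
    intro s
    rw [inter_comm, ← Measure.restrict_restrict measurableSet_Iio,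
      ← integral_indicator measurableSet_Iio]
    congr 1
  simp_rw [e1, e2]
  exact h3

lemma s4_int (a b : ℝ) (k : ℝ × ℝ → ℂ) (hk : Continuous k) (f : ℝ → ℂ)
    (hf : IntegrableOn f (Ioo (0:ℝ) b)) :
    Integrable (fun p : ℝ × ℝ => k p * f p.2)
      ((volume.restrict (Ioo (0:ℝ) a)).prod (volume.restrict (Ioo (0:ℝ) b))) := by
  have hf2 : Integrable (fun p : ℝ × ℝ => f p.2)
      ((volume.restrict (Ioo (0:ℝ) a)).prod (volume.restrict (Ioo (0:ℝ) b))) :=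
    Integrable.comp_snd hf _
  obtain ⟨C, hC⟩ := ((isCompact_Icc (a := (0:ℝ)) (b := a)).prod
    (isCompact_Icc (a := (0:ℝ)) (b := b))).exists_bound_of_continuousOn hk.continuousOn
  refine hf2.bdd_mul (c := C) hk.aestronglyMeasurable ?_
  rw [Measure.prod_restrict]
  filter_upwards [ae_restrict_mem (measurableSet_Ioo.prod measurableSet_Ioo)] with p hp
  exact hC p ⟨Ioo_subset_Icc_self hp.1, Ioo_subset_Icc_self hp.2⟩

/-- the kernel -/
def s4K (g h : ℝ → ℂ) (x t : ℝ) : ℂ := ∫ r in (0:ℝ)..(min x t), g (x - r) * h (t - r)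

lemma s4K_cont (g h : ℝ → ℂ) (hg : Continuous g) (hh : Continuous h) :
    Continuous (fun p : ℝ × ℝ => s4K g h p.1 p.2) := by
  unfold s4K
  apply intervalIntegral.continuous_parametric_intervalIntegral_of_continuous
  · simp only [Function.uncurry_def]; fun_prop
  · fun_prop

lemma s4K_symm (g h : ℝ → ℂ) (x t : ℝ) : s4K g h x t = s4K h g t x := by
  unfold s4K
  rw [min_comm]
  simp_rw [mul_comm]

lemma s4_ker (l : ℝ) (φ ψ g h : ℝ → ℂ)
    (hg : ∀ u ∈ Icc (0:ℝ) l, φ u = g u) (hh : ∀ u ∈ Icc (0:ℝ) l, ψ u = h u)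
    (x t : ℝ) (hx : x ∈ Ioo (0:ℝ) l) (ht : t ∈ Ioo (0:ℝ) l) :
    -(1/2 : ℂ) * ∫ ξ in Ioo |x - t| (x + t), φ ((ξ + x - t)/2) * ψ ((ξ + t - x)/2)
      = - s4K g h x t := by
  obtain ⟨hx0, hxl⟩ := hx
  obtain ⟨ht0, htl⟩ := ht
  have e1 : ∫ ξ in Ioo |x - t| (x + t), φ ((ξ + x - t)/2) * ψ ((ξ + t - x)/2) =
      ∫ ξ in Ioo |x - t| (x + t), g ((ξ + x - t)/2) * h ((ξ + t - x)/2) := by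
    apply setIntegral_congr_fun measurableSet_Ioo
    intro ξ hξ
    obtain ⟨h1, h2⟩ := hξ
    obtain ⟨h3, h4⟩ := abs_lt.1 h1
    simp only
    rw [hg _ ⟨by linarith, by linarith⟩, hh _ ⟨by linarith, by linarith⟩]
  have hle : |x - t| ≤ x + t := abs_le.2 ⟨by linarith, by linarith⟩
  rw [e1, ← integral_Ioc_eq_integral_Ioo, ← intervalIntegral.integral_of_le hle]
  have e2 := intervalIntegral.integral_comp_sub_mul (a := 0) (b := min x t)
    (fun ξ => g ((ξ + x - t)/2) * h ((ξ + t - x)/2)) (c := 2) two_ne_zero (x + t)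
  have e3 : x + t - 2 * min x t = |x - t| := by
    rcases le_total x t with h | h
    · rw [min_eq_left h, abs_of_nonpos (by linarith)]; ring
    · rw [min_eq_right h, abs_of_nonneg (by linarith)]; ring
  rw [e3, mul_zero, sub_zero] at e2
  have e4 : s4K g h x t = ∫ r in (0:ℝ)..(min x t),
      g ((x + t - 2 * r + x - t)/2) * h ((x + t - 2 * r + t - x)/2) := by
    unfold s4K
    congr 1; ext r; congr 2 <;> ring
  rw [e4, e2, Complex.real_smul]
  push_cast
  ring

lemma s4_half (g h : ℝ → ℂ) (hg : Continuous g) (hh : Continuous h) (x t : ℝ)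
    (hx : 0 ≤ x) (ht : 0 ≤ t) :
    ∫ s in Ioo (0:ℝ) x, s4K g h s t =
      ∫ r in (0:ℝ)..(min x t), (∫ s in (0:ℝ)..(x - r), g s) * h (t - r) := by
  have hm : 0 ≤ min x t := le_min hx ht
  have hT := s4_tri x (min x t) (fun r s => g (s - r) * h (t - r)) (by
    have := s4_int (min x t) x (fun p => g (p.2 - p.1) * h (t - p.1)) (by fun_prop) (fun _ => 1)
      (by simp [IntegrableOn])
    simpa [Function.uncurry_def] using this)
  rw [intervalIntegral.integral_of_le hm, integral_Ioc_eq_integral_Ioo]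
  calc _ = ∫ s in Ioo (0:ℝ) x, ∫ r in Ioo (0:ℝ) (min x t) ∩ Iio s, g (s - r) * h (t - r) := by
        apply setIntegral_congr_fun measurableSet_Ioo
        intro s hs
        have : Ioo (0:ℝ) (min x t) ∩ Iio s = Ioo 0 (min s t) := by
          ext r
          simp only [mem_inter_iff, mem_Ioo, mem_Iio, lt_min_iff]
          constructor
          · rintro ⟨⟨a, b, c⟩, d⟩; exact ⟨a, d, c⟩
          · rintro ⟨a, b, c⟩; exact ⟨⟨a, b.trans hs.2, c⟩, b⟩
        simp only [this]
        rw [s4K, intervalIntegral.integral_of_le (le_min hs.1.le ht), integral_Ioc_eq_integral_Ioo]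
    _ = _ := hT.symm
    _ = _ := by
        apply setIntegral_congr_fun measurableSet_Ioo
        intro r hr
        have hrx : r < x := hr.2.trans_le (min_le_left _ _)
        have : Ioo (0:ℝ) x ∩ Ioi r = Ioo r x := by
          ext s
          simp only [mem_inter_iff, mem_Ioo, mem_Ioi]
          constructor
          · rintro ⟨⟨a, b⟩, c⟩; exact ⟨c, b⟩
          · rintro ⟨a, b⟩; exact ⟨⟨hr.1.trans a, b⟩, a⟩
        simp only [this]
        rw [integral_mul_const, ← integral_Ioc_eq_integral_Ioo,
          ← intervalIntegral.integral_of_le hrx.le, intervalIntegral.integral_comp_sub_right g r,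
          sub_self]

lemma s4_id (g h : ℝ → ℂ) (hg : Continuous g) (hh : Continuous h) (x t : ℝ)
    (hx : 0 ≤ x) (ht : 0 ≤ t) :
    (∫ s in Ioo (0:ℝ) x, s4K g h s t) + (∫ s in Ioo (0:ℝ) t, s4K g h x s) =
      (∫ s in (0:ℝ)..x, g s) * (∫ s in (0:ℝ)..t, h s) := by
  have h2 : ∫ s in Ioo (0:ℝ) t, s4K g h x s =
      ∫ r in (0:ℝ)..(min x t), (∫ s in (0:ℝ)..(t - r), h s) * g (x - r) := by
    simp_rw [s4K_symm g h]
    rw [s4_half h g hh hg t x ht hx, min_comm]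
  rw [s4_half g h hg hh x t hx ht, h2]
  have hGd : ∀ (g : ℝ → ℂ), Continuous g → ∀ x r : ℝ,
      HasDerivAt (fun r => ∫ s in (0:ℝ)..(x - r), g s) (- g (x - r)) r := by
    intro g hg x r
    have := (hg.integral_hasStrictDerivAt 0 (x - r)).hasDerivAt
    have h3 := this.scomp r ((hasDerivAt_id r).const_sub x)
    have e : (-1 : ℝ) • g (x - r) = - g (x - r) := by simp
    rw [← e]
    exact h3
  have hGc : ∀ (g : ℝ → ℂ), Continuous g → ∀ x : ℝ,
      Continuous (fun r => ∫ s in (0:ℝ)..(x - r), g s) := fun g hg x =>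
    continuous_iff_continuousAt.2 fun r => (hGd g hg x r).continuousAt
  have c1 := hGc g hg x
  have c2 := hGc h hh t
  rw [← intervalIntegral.integral_add
    (Continuous.intervalIntegrable (by fun_prop) _ _) (Continuous.intervalIntegrable (by fun_prop) _ _)]
  have key := intervalIntegral.integral_eq_sub_of_hasDerivAt (a := 0) (b := min x t)
    (f := fun r => -((∫ s in (0:ℝ)..(x - r), g s) * (∫ s in (0:ℝ)..(t - r), h s)))
    (f' := fun r => (∫ s in (0:ℝ)..(x - r), g s) * h (t - r) +
      (∫ s in (0:ℝ)..(t - r), h s) * g (x - r))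
    (fun r _ => by
      have h5 := ((hGd g hg x r).mul (hGd h hh t r)).neg
      have e : (∫ s in (0:ℝ)..(x - r), g s) * h (t - r) + (∫ s in (0:ℝ)..(t - r), h s) * g (x - r)
        = -((-g (x - r) * ∫ s in (0:ℝ)..(t - r), h s) +
          (∫ s in (0:ℝ)..(x - r), g s) * -h (t - r)) := by ring
      rw [e]
      exact h5) (Continuous.intervalIntegrable (by fun_prop) _ _)
  rw [key]
  rcases le_total x t with hxt | hxt
  · simp [min_eq_left hxt]
  · simp [min_eq_right hxt]

/-- Lemma of [FKS1]: for C¹ functions `Φ, Ψ` on `[0,l]` vanishing at `0`,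
the integral operator `S` with kernel
`-(1/2) ∫_{|x-t|}^{x+t} Φ'((ξ+x-t)/2) Ψ'((ξ+t-x)/2) dξ`
satisfies `A S - S A* = i Φ(x) ∫₀ˡ Ψ(t) · dt`. -/
theorem identity_for_S4 (l : ℝ) (hl : 0 < l) (Φ Ψ : ℝ → ℂ)
    (hΦ : ContDiffOn ℝ 1 Φ (Icc (0:ℝ) l)) (hΨ : ContDiffOn ℝ 1 Ψ (Icc (0:ℝ) l))
    (hΦ0 : Φ 0 = 0) (hΨ0 : Ψ 0 = 0)
    (A Astar S : Lp ℂ 2 (volume.restrict (Ioo (0:ℝ) l)) →L[ℂ] Lp ℂ 2 (volume.restrict (Ioo (0:ℝ) l)))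
    (hA : ∀ f : Lp ℂ 2 (volume.restrict (Ioo (0:ℝ) l)),
      ⇑(A f) =ᵐ[volume.restrict (Ioo (0:ℝ) l)]
        fun x => -Complex.I * ∫ t in Ioo (0:ℝ) x, f t)
    (hAstar : ∀ f : Lp ℂ 2 (volume.restrict (Ioo (0:ℝ) l)),
      ⇑(Astar f) =ᵐ[volume.restrict (Ioo (0:ℝ) l)]
        fun x => Complex.I * ∫ t in Ioo x l, f t)
    (hS : ∀ f : Lp ℂ 2 (volume.restrict (Ioo (0:ℝ) l)),
      ⇑(S f) =ᵐ[volume.restrict (Ioo (0:ℝ) l)]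
        fun x => ∫ t in Ioo (0:ℝ) l,
          (-(1/2 : ℂ) * ∫ ξ in Ioo |x - t| (x + t),
            derivWithin Φ (Icc (0:ℝ) l) ((ξ + x - t)/2) *
            derivWithin Ψ (Icc (0:ℝ) l) ((ξ + t - x)/2)) * f t) :
    ∀ f : Lp ℂ 2 (volume.restrict (Ioo (0:ℝ) l)),
      ⇑(A (S f) - S (Astar f)) =ᵐ[volume.restrict (Ioo (0:ℝ) l)]
        fun x => Complex.I * Φ x * ∫ t in Ioo (0:ℝ) l, Ψ t * f t := by
  intro f
  obtain ⟨g, hgc, hgφ, hgΦ⟩ := s4_ext l hl Φ hΦ hΦ0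
  obtain ⟨h, hhc, hhψ, hhΨ⟩ := s4_ext l hl Ψ hΨ hΨ0
  have hKc := s4K_cont g h hgc hhc
  have hfi : ∀ f : Lp ℂ 2 (volume.restrict (Ioo (0:ℝ) l)), IntegrableOn f (Ioo (0:ℝ) l) :=
    fun f => (Lp.memLp f).integrable (by norm_num)
  have hS' : ∀ f : Lp ℂ 2 (volume.restrict (Ioo (0:ℝ) l)),
      ⇑(S f) =ᵐ[volume.restrict (Ioo (0:ℝ) l)]
        fun x => ∫ t in Ioo (0:ℝ) l, -s4K g h x t * f t := by
    intro f
    filter_upwards [hS f, ae_restrict_mem measurableSet_Ioo] with x hx hxm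
    rw [hx]
    apply setIntegral_congr_fun measurableSet_Ioo
    intro t ht
    simp only
    rw [s4_ker l _ _ g h hgφ hhψ x t hxm ht]
  filter_upwards [Lp.coeFn_sub (A (S f)) (S (Astar f)), hA (S f), hS' (Astar f),
    ae_restrict_mem measurableSet_Ioo] with x h1 h2 h3 hx
  rw [h1, Pi.sub_apply, h2, h3]
  have hsub : Ioo (0:ℝ) x ⊆ Ioo (0:ℝ) l := Ioo_subset_Ioo_right hx.2.le
  have kx : Continuous (fun s => s4K g h x s) := hKc.comp (Continuous.prodMk_right x)
  -- first term
  have t1 : ∫ s in Ioo (0:ℝ) x, (S f) s =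
      ∫ t in Ioo (0:ℝ) l, (-∫ s in Ioo (0:ℝ) x, s4K g h s t) * f t := by
    have : ∫ s in Ioo (0:ℝ) x, (S f) s =
        ∫ s in Ioo (0:ℝ) x, ∫ t in Ioo (0:ℝ) l, -s4K g h s t * f t :=
      integral_congr_ae (ae_restrict_of_ae_restrict_of_subset hsub (hS' f))
    rw [this, integral_integral_swap (f := fun s t => -s4K g h s t * f t)
      (s4_int x l (fun p => -s4K g h p.1 p.2) hKc.neg f (hfi f))]
    congr 1; ext t
    rw [integral_mul_const, integral_neg]
  have t2 : ∫ s in Ioo (0:ℝ) l, -s4K g h x s * (Astar f) s =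
      Complex.I * ∫ t in Ioo (0:ℝ) l, (-∫ s in Ioo (0:ℝ) t, s4K g h x s) * f t := by
    have hT := s4_tri l l (fun s t => -s4K g h x s * f t)
      (s4_int l l (fun p => -s4K g h x p.1) (kx.comp continuous_fst).neg f (hfi f))
    have e1 : ∫ s in Ioo (0:ℝ) l, -s4K g h x s * (Astar f) s =
        ∫ s in Ioo (0:ℝ) l, Complex.I * ∫ t in Ioo (0:ℝ) l ∩ Ioi s, -s4K g h x s * f t := by
      apply integral_congr_ae
      filter_upwards [hAstar f, ae_restrict_mem measurableSet_Ioo] with s hs hsm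
      have : Ioo (0:ℝ) l ∩ Ioi s = Ioo s l := by
        ext r
        simp only [mem_inter_iff, mem_Ioo, mem_Ioi]
        constructor
        · rintro ⟨⟨a, b⟩, c⟩; exact ⟨c, b⟩
        · rintro ⟨a, b⟩; exact ⟨⟨hsm.1.trans a, b⟩, a⟩
      rw [hs, this, integral_const_mul]
      ring
    rw [e1, integral_const_mul, hT]
    congr 1
    apply setIntegral_congr_fun measurableSet_Ioo
    intro t ht
    have : Ioo (0:ℝ) l ∩ Iio t = Ioo 0 t := by
      ext r
      simp only [mem_inter_iff, mem_Ioo, mem_Iio]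
      constructor
      · rintro ⟨⟨a, b⟩, c⟩; exact ⟨a, c⟩
      · rintro ⟨a, b⟩; exact ⟨⟨a, b.trans ht.2⟩, b⟩
    simp only [this]
    rw [integral_mul_const, integral_neg]
  rw [t1, t2]
  have i1 : Integrable (fun t => (-∫ s in Ioo (0:ℝ) x, s4K g h s t) * f t)
      (volume.restrict (Ioo (0:ℝ) l)) := by
    have := (s4_int x l (fun p => -s4K g h p.1 p.2) hKc.neg f (hfi f)).integral_prod_right
    refine this.congr (Filter.Eventually.of_forall fun t => ?_)
    simp only
    rw [integral_mul_const, integral_neg]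
  have i3 : Integrable (fun t => Ψ t * f t) (volume.restrict (Ioo (0:ℝ) l)) := by
    obtain ⟨C, hC⟩ := (isCompact_Icc (a := (0:ℝ)) (b := l)).exists_bound_of_continuousOn
      hΨ.continuousOn
    refine (hfi f).bdd_mul (c := C)
      ((hΨ.continuousOn.mono Ioo_subset_Icc_self).aestronglyMeasurable measurableSet_Ioo) ?_
    filter_upwards [ae_restrict_mem measurableSet_Ioo] with p hp
    exact hC p (Ioo_subset_Icc_self hp)
  have e2 : ∫ t in Ioo (0:ℝ) l, (-∫ s in Ioo (0:ℝ) t, s4K g h x s) * f t =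
      ∫ t in Ioo (0:ℝ) l, (-(Φ x) * (Ψ t * f t) -
        (-∫ s in Ioo (0:ℝ) x, s4K g h s t) * f t) := by
    apply setIntegral_congr_fun measurableSet_Ioo
    intro t ht
    have := s4_id g h hgc hhc x t hx.1.le ht.1.le
    rw [← hgΦ x (Ioo_subset_Icc_self hx), ← hhΨ t (Ioo_subset_Icc_self ht)] at this
    simp only
    linear_combination (-(f t)) * this
  rw [e2, integral_sub (i3.const_mul _) i1, integral_const_mul]
  ring
end
end

section
/- Let φ : [0,l] → ℂ be continuously differentiable, and define the operator S on L²(0,l) by (Sf)(x) = (1 - |φ(0)|²) f(x) - ∫₀ˡ s(x,t) f(t) dt, where s(x,t) = ∫₀^{min(x,t)} φ'(x-ζ) conj(φ'(t-ζ)) dζ + φ'(x-t) conj(φ(0)) for x > t and + φ(0) conj(φ'(t-x)) for t > x. Then S satisfies the operator identity A S - S A* = i (Φ₁ Φ₁* - Φ₂ Φ₂*), where (Af)(x) = -i ∫₀ˣ f(t) dt, Φ₁ : ℂ → L²(0,l) is c ↦ φ(·) c, and Φ₂ : ℂ → L²(0,l) is c ↦ c·1. -/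
open MeasureTheory Set

noncomputable section

/-- The "close to displacement" kernel `s(x,t)` built from a C¹ function `φ` on `[0,l]`:
`s(x,t) = ∫₀^{min(x,t)} φ'(x-ζ) conj(φ'(t-ζ)) dζ + φ'(x-t) conj(φ(0))` for `x > t`,
and `+ φ(0) conj(φ'(t-x))` for `t > x`. -/
def closeToDisplacementKernel (l : ℝ) (φ : ℝ → ℂ) (x t : ℝ) : ℂ :=
  (∫ ζ in Ioo (0:ℝ) (min x t),
      derivWithin φ (Icc (0:ℝ) l) (x - ζ) *
      (starRingEnd ℂ) (derivWithin φ (Icc (0:ℝ) l) (t - ζ))) +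
  (if t < x then derivWithin φ (Icc (0:ℝ) l) (x - t) * (starRingEnd ℂ) (φ 0)
   else if x < t then φ 0 * (starRingEnd ℂ) (derivWithin φ (Icc (0:ℝ) l) (t - x))
   else 0)

/-- primitive of `g`. -/
def dP (g : ℝ → ℂ) (y : ℝ) : ℂ := ∫ t in (0:ℝ)..y, g t

/-- extended kernel. -/
def dK (g : ℝ → ℂ) (c : ℂ) (l u v : ℝ) : ℂ :=
  (∫ ζ in (0:ℝ)..l, g (u - ζ) * (starRingEnd ℂ) (g (v - ζ)))
    + g (u - v) * (starRingEnd ℂ) c + c * (starRingEnd ℂ) (g (v - u))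

lemma ii_of_bdd {h : ℝ → ℂ} (hm : Measurable h) {M : ℝ} (hb : ∀ y, ‖h y‖ ≤ M) (a b : ℝ) :
    IntervalIntegrable h volume a b := by
  refine (intervalIntegrable_const (c := M)).mono_fun hm.aestronglyMeasurable ?_
  refine Filter.Eventually.of_forall fun y => ?_
  have := hb y
  simpa using this.trans (le_abs_self M)

lemma conj_norm_le {g : ℝ → ℂ} {M : ℝ} (hb : ∀ y, ‖g y‖ ≤ M) (y : ℝ) :
    ‖(starRingEnd ℂ) (g y)‖ ≤ M := by
  rw [RCLike.norm_conj]; exact hb y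

lemma mul_norm_le {a b : ℂ} {M N : ℝ} (ha : ‖a‖ ≤ M) (hb : ‖b‖ ≤ N) : ‖a * b‖ ≤ M * N := by
  rw [norm_mul]
  exact mul_le_mul ha hb (norm_nonneg _) ((norm_nonneg _).trans ha)

lemma swap_bdd {F : ℝ → ℝ → ℂ} (hm : Measurable (Function.uncurry F)) {M : ℝ}
    (hb : ∀ x y, ‖F x y‖ ≤ M) (a b c d : ℝ) :
    ∫ x in a..b, ∫ y in c..d, F x y = ∫ y in c..d, ∫ x in a..b, F x y := by
  apply intervalIntegral_intervalIntegral_swap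
  refine Measure.integrableOn_of_bounded (M := M) ?_ hm.aestronglyMeasurable
    (Filter.Eventually.of_forall fun p => hb p.1 p.2)
  rw [Measure.volume_eq_prod, Measure.prod_prod]
  simp [uIoc, ENNReal.mul_eq_top]

section
variable {g : ℝ → ℂ} (hm : Measurable g) {M : ℝ} (hb : ∀ y, ‖g y‖ ≤ M)
  (hg0 : ∀ y < 0, g y = 0) (hgc : ∀ y, y ≠ 0 → ContinuousAt g y)

lemma dP_nonpos (hg0 : ∀ y < 0, g y = 0) {y : ℝ} (hy : y ≤ 0) : dP g y = 0 := by
  unfold dP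
  rw [intervalIntegral.integral_symm, intervalIntegral.integral_of_le hy,
    integral_Ioc_eq_integral_Ioo, setIntegral_eq_zero_of_forall_eq_zero, neg_zero]
  intro t ht
  exact hg0 t ht.2

lemma dP_sub (hm : Measurable g) (hb : ∀ y, ‖g y‖ ≤ M) (a b : ℝ) :
    ∫ t in a..b, g t = dP g b - dP g a := by
  unfold dP
  rw [intervalIntegral.integral_interval_sub_left] <;> exact ii_of_bdd hm hb _ _

lemma dP_cont (hm : Measurable g) (hb : ∀ y, ‖g y‖ ≤ M) : Continuous (dP g) :=
  intervalIntegral.continuous_primitive (fun a b => ii_of_bdd hm hb a b) 0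

lemma dP_deriv (hm : Measurable g) (hb : ∀ y, ‖g y‖ ≤ M)
    (hgc : ∀ y, y ≠ 0 → ContinuousAt g y) {y : ℝ} (hy : y ≠ 0) :
    HasDerivAt (dP g) (g y) y :=
  intervalIntegral.integral_hasDerivAt_right (ii_of_bdd hm hb _ _)
    hm.stronglyMeasurable.stronglyMeasurableAtFilter (hgc y hy)

lemma conj_ii (a b : ℝ) (h : ℝ → ℂ) :
    ∫ t in a..b, (starRingEnd ℂ) (h t) = (starRingEnd ℂ) (∫ t in a..b, h t) := by
  simp only [intervalIntegral]
  rw [integral_conj, integral_conj, map_sub]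

/-- product rule. -/
lemma dP_prod (hm : Measurable g) (hb : ∀ y, ‖g y‖ ≤ M)
    (hg0 : ∀ y < 0, g y = 0) (hgc : ∀ y, y ≠ 0 → ContinuousAt g y)
    {l x v : ℝ} (hx : x ≤ l) :
    (∫ ζ in (0:ℝ)..l, dP g (x - ζ) * (starRingEnd ℂ) (g (v - ζ)))
      + (∫ ζ in (0:ℝ)..l, g (x - ζ) * (starRingEnd ℂ) (dP g (v - ζ)))
      = dP g x * (starRingEnd ℂ) (dP g v) := by
  have hc := dP_cont hm hb
  have cm : ∀ w, Measurable fun ζ => (starRingEnd ℂ) (g (w - ζ)) := fun w =>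
    Complex.continuous_conj.measurable.comp (hm.comp (measurable_const.sub measurable_id))
  have gm : ∀ w, Measurable fun ζ => g (w - ζ) := fun w =>
    (hm.comp (measurable_const.sub measurable_id))
  have i1 : IntervalIntegrable (fun ζ => dP g (x - ζ) * (starRingEnd ℂ) (g (v - ζ))) volume 0 l :=
    (ii_of_bdd (cm v) (fun y => conj_norm_le hb _) 0 l).continuousOn_mul
      (by fun_prop)
  have i2 : IntervalIntegrable (fun ζ => g (x - ζ) * (starRingEnd ℂ) (dP g (v - ζ))) volume 0 l :=
    (ii_of_bdd (gm x) (fun y => hb _) 0 l).mul_continuousOn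
      (Complex.continuous_conj.comp (by fun_prop)).continuousOn
  rw [← intervalIntegral.integral_add i1 i2]
  have key := integral_eq_of_hasDerivAt_off_countable
    (fun ζ => -(dP g (x - ζ) * (starRingEnd ℂ) (dP g (v - ζ))))
    (fun ζ => dP g (x - ζ) * (starRingEnd ℂ) (g (v - ζ)) +
      g (x - ζ) * (starRingEnd ℂ) (dP g (v - ζ))) (a := 0) (b := l) (s := {x, v})
      (by simp) ?_ ?_ (i1.add i2)
  · rw [key, dP_nonpos hg0 (show x - l ≤ 0 by linarith)]
    simp
  · exact (((hc.comp (by fun_prop)).mul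
      (Complex.continuous_conj.comp (hc.comp (by fun_prop)))).neg).continuousOn
  · intro ζ hζ
    have h1 : x - ζ ≠ 0 := by
      intro h; apply hζ.2; left; linarith
    have h2 : v - ζ ≠ 0 := by
      intro h; apply hζ.2; right; simp only [mem_singleton_iff]; linarith
    have d1 := (dP_deriv hm hb hgc h1).scomp ζ ((hasDerivAt_id ζ).const_sub x)
    have d2 := ((dP_deriv hm hb hgc h2).scomp ζ ((hasDerivAt_id ζ).const_sub v)).star
    have := (d1.mul d2).neg
    have e : dP g (x - ζ) * (starRingEnd ℂ) (g (v - ζ)) +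
        g (x - ζ) * (starRingEnd ℂ) (dP g (v - ζ)) =
        -(-1 • g (x - ζ) * star ((dP g ∘ HSub.hSub v) ζ) +
          (dP g ∘ HSub.hSub x) ζ * star (-1 • g (v - ζ))) := by
      simp
    simp only [neg_smul, one_smul, star_neg, Function.comp_apply] at this e
    rw [e]
    exact this

lemma dK_meas (hm : Measurable g) (c : ℂ) (l : ℝ) : Measurable (Function.uncurry (dK g c l)) := by
  have hcj := Complex.continuous_conj.measurable
  have h1 : StronglyMeasurable (fun p : ℝ × ℝ =>
      ∫ ζ in (0:ℝ)..l, g (p.1 - ζ) * (starRingEnd ℂ) (g (p.2 - ζ))) := by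
    have hF : StronglyMeasurable (fun q : (ℝ × ℝ) × ℝ =>
      g (q.1.1 - q.2) * (starRingEnd ℂ) (g (q.1.2 - q.2))) := by
      apply Measurable.stronglyMeasurable
      exact (hm.comp (by fun_prop)).mul (hcj.comp (hm.comp (by fun_prop)))
    simp only [intervalIntegral]
    exact (hF.integral_prod_right (ν := volume.restrict (Ioc 0 l))).sub
      (hF.integral_prod_right (ν := volume.restrict (Ioc l 0)))
  refine (h1.measurable.add ?_).add ?_
  · exact (hm.comp (by fun_prop)).mul measurable_const
  · exact measurable_const.mul (hcj.comp (hm.comp (by fun_prop)))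

lemma dK_bdd (hb : ∀ y, ‖g y‖ ≤ M) (c : ℂ) (l u v : ℝ) :
    ‖dK g c l u v‖ ≤ M * M * |l - 0| + M * ‖c‖ + ‖c‖ * M := by
  unfold dK
  refine (norm_add_le _ _).trans (add_le_add ((norm_add_le _ _).trans (add_le_add ?_ ?_)) ?_)
  · exact intervalIntegral.norm_integral_le_of_norm_le_const
      (fun ζ _ => mul_norm_le (hb _) (conj_norm_le hb _))
  · exact mul_norm_le (hb _) (by rw [RCLike.norm_conj])
  · exact mul_norm_le le_rfl (conj_norm_le hb _)

lemma dK_identity (hm : Measurable g) (hb : ∀ y, ‖g y‖ ≤ M)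
    (hg0 : ∀ y < 0, g y = 0) (hgc : ∀ y, y ≠ 0 → ContinuousAt g y) (c : ℂ)
    {l x v : ℝ} (hx0 : 0 ≤ x) (hv0 : 0 ≤ v) (hx : x ≤ l) :
    (∫ u in (0:ℝ)..x, dK g c l u v) + (∫ t in (0:ℝ)..v, dK g c l x t) =
      dP g x * (starRingEnd ℂ) (dP g v) + dP g x * (starRingEnd ℂ) c
        + c * (starRingEnd ℂ) (dP g v) := by
  have hcj := Complex.continuous_conj.measurable
  have hl : 0 ≤ l := hx0.trans hx
  -- double integral parts
  have e1 : ∫ u in (0:ℝ)..x, (∫ ζ in (0:ℝ)..l, g (u - ζ) * (starRingEnd ℂ) (g (v - ζ)))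
      = ∫ ζ in (0:ℝ)..l, dP g (x - ζ) * (starRingEnd ℂ) (g (v - ζ)) := by
    rw [swap_bdd (F := fun u ζ => g (u - ζ) * (starRingEnd ℂ) (g (v - ζ)))
      ((hm.comp (by fun_prop)).mul (hcj.comp (hm.comp (by fun_prop))))
      (fun a b => mul_norm_le (hb _) (conj_norm_le hb _))]
    refine intervalIntegral.integral_congr fun ζ hζ => ?_
    rw [uIcc_of_le hl] at hζ
    beta_reduce
    rw [intervalIntegral.integral_mul_const, intervalIntegral.integral_comp_sub_right,
      dP_sub hm hb, dP_nonpos hg0 (show 0 - ζ ≤ 0 by linarith [hζ.1]), sub_zero]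
  have e2 : ∫ t in (0:ℝ)..v, (∫ ζ in (0:ℝ)..l, g (x - ζ) * (starRingEnd ℂ) (g (t - ζ)))
      = ∫ ζ in (0:ℝ)..l, g (x - ζ) * (starRingEnd ℂ) (dP g (v - ζ)) := by
    rw [swap_bdd (F := fun t ζ => g (x - ζ) * (starRingEnd ℂ) (g (t - ζ)))
      ((hm.comp (by fun_prop)).mul (hcj.comp (hm.comp (by fun_prop))))
      (fun a b => mul_norm_le (hb _) (conj_norm_le hb _))]
    refine intervalIntegral.integral_congr fun ζ hζ => ?_
    rw [uIcc_of_le hl] at hζ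
    beta_reduce
    rw [intervalIntegral.integral_const_mul, conj_ii, intervalIntegral.integral_comp_sub_right,
      dP_sub hm hb, dP_nonpos hg0 (show 0 - ζ ≤ 0 by linarith [hζ.1]), sub_zero]
  have hK : Measurable (Function.uncurry (dK g c l)) := dK_meas hm c l
  have hI : Measurable (Function.uncurry
      (fun u v => ∫ ζ in (0:ℝ)..l, g (u - ζ) * (starRingEnd ℂ) (g (v - ζ)))) := by
    have := dK_meas hm 0 l
    simpa [dK, Function.uncurry_def] using this
  have hIb : ∀ u v, ‖∫ ζ in (0:ℝ)..l, g (u - ζ) * (starRingEnd ℂ) (g (v - ζ))‖ ≤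
      M * M * |l - 0| := fun u v => intervalIntegral.norm_integral_le_of_norm_le_const
      (fun ζ _ => mul_norm_le (hb _) (conj_norm_le hb _))
  have s1 : ∫ u in (0:ℝ)..x, dK g c l u v =
      (∫ ζ in (0:ℝ)..l, dP g (x - ζ) * (starRingEnd ℂ) (g (v - ζ)))
      + dP g (x - v) * (starRingEnd ℂ) c
      + c * (starRingEnd ℂ) (dP g v - dP g (v - x)) := by
    unfold dK
    rw [intervalIntegral.integral_add, intervalIntegral.integral_add, e1,
      intervalIntegral.integral_mul_const, intervalIntegral.integral_const_mul, conj_ii,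
      intervalIntegral.integral_comp_sub_right, intervalIntegral.integral_comp_sub_left,
      dP_sub hm hb, dP_sub hm hb, dP_nonpos hg0 (show 0 - v ≤ 0 by linarith), sub_zero, sub_zero]
    · exact ii_of_bdd (hI.comp (by fun_prop : Measurable fun u : ℝ => (u, v))) (fun u => hIb u v) _ _
    · exact ii_of_bdd (M := M * ‖c‖) ((hm.comp (by fun_prop)).mul measurable_const)
        (fun u => mul_norm_le (hb _) (by rw [RCLike.norm_conj])) _ _
    · refine IntervalIntegrable.add ?_ ?_
      · exact ii_of_bdd (hI.comp (by fun_prop : Measurable fun u : ℝ => (u, v))) (fun u => hIb u v) _ _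
      · exact ii_of_bdd (M := M * ‖c‖) ((hm.comp (by fun_prop)).mul measurable_const)
          (fun u => mul_norm_le (hb _) (by rw [RCLike.norm_conj])) _ _
    · exact ii_of_bdd (M := ‖c‖ * M) (measurable_const.mul (hcj.comp (hm.comp (by fun_prop))))
        (fun u => mul_norm_le le_rfl (conj_norm_le hb _)) _ _
  have s2 : ∫ t in (0:ℝ)..v, dK g c l x t =
      (∫ ζ in (0:ℝ)..l, g (x - ζ) * (starRingEnd ℂ) (dP g (v - ζ)))
      + (dP g x - dP g (x - v)) * (starRingEnd ℂ) c
      + c * (starRingEnd ℂ) (dP g (v - x)) := by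
    unfold dK
    rw [intervalIntegral.integral_add, intervalIntegral.integral_add, e2,
      intervalIntegral.integral_mul_const, intervalIntegral.integral_const_mul, conj_ii,
      intervalIntegral.integral_comp_sub_right, intervalIntegral.integral_comp_sub_left,
      dP_sub hm hb, dP_sub hm hb, dP_nonpos hg0 (show 0 - x ≤ 0 by linarith), sub_zero, sub_zero]
    · exact ii_of_bdd (hI.comp (by fun_prop : Measurable fun u : ℝ => (x, u))) (fun u => hIb x u) _ _
    · exact ii_of_bdd (M := M * ‖c‖) ((hm.comp (by fun_prop)).mul measurable_const)
        (fun u => mul_norm_le (hb _) (by rw [RCLike.norm_conj])) _ _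
    · refine IntervalIntegrable.add ?_ ?_
      · exact ii_of_bdd (hI.comp (by fun_prop : Measurable fun u : ℝ => (x, u))) (fun u => hIb x u) _ _
      · exact ii_of_bdd (M := M * ‖c‖) ((hm.comp (by fun_prop)).mul measurable_const)
          (fun u => mul_norm_le (hb _) (by rw [RCLike.norm_conj])) _ _
    · exact ii_of_bdd (M := ‖c‖ * M) (measurable_const.mul (hcj.comp (hm.comp (by fun_prop))))
        (fun u => mul_norm_le le_rfl (conj_norm_le hb _)) _ _
  rw [s1, s2, ← dP_prod hm hb hg0 hgc (v := v) hx, map_sub]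
  ring

end

lemma op_swap {k : ℝ → ℝ → ℂ} (hk : Measurable (Function.uncurry k)) {N : ℝ}
    (hN : ∀ u v, ‖k u v‖ ≤ N) {l x : ℝ} (hx : x ∈ Ioo (0:ℝ) l) {f : ℝ → ℂ}
    (hf : Integrable f (volume.restrict (Ioo (0:ℝ) l))) :
    IntegrableOn (fun u => ∫ v in Ioo (0:ℝ) l, k u v * f v) (Ioo 0 x) ∧
    (∫ u in Ioo (0:ℝ) x, ∫ v in Ioo (0:ℝ) l, k u v * f v) +
      (∫ t in Ioo (0:ℝ) l, k x t * ∫ v in Ioo t l, f v)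
    = ∫ v in Ioo (0:ℝ) l, ((∫ u in (0:ℝ)..x, k u v) + ∫ t in (0:ℝ)..v, k x t) * f v := by
  have hkx : Measurable (k x) := hk.comp (by fun_prop : Measurable fun t : ℝ => (x, t))
  have I1 : Integrable (fun p : ℝ × ℝ => k p.1 p.2 * f p.2)
      ((volume.restrict (Ioo (0:ℝ) x)).prod (volume.restrict (Ioo (0:ℝ) l))) :=
    (hf.comp_snd _).bdd_mul (c := N) hk.aestronglyMeasurable
      (Filter.Eventually.of_forall fun p => hN _ _)
  let k2 : ℝ → ℝ → ℂ := fun t v => if t < v then k x t else 0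
  have hk2 : Measurable (Function.uncurry k2) :=
    Measurable.ite (measurableSet_lt measurable_fst measurable_snd)
      (hkx.comp measurable_fst) measurable_const
  have hN0 : 0 ≤ N := (norm_nonneg _).trans (hN 0 0)
  have I2 : Integrable (fun p : ℝ × ℝ => k2 p.1 p.2 * f p.2)
      ((volume.restrict (Ioo (0:ℝ) l)).prod (volume.restrict (Ioo (0:ℝ) l))) := by
    refine (hf.comp_snd _).bdd_mul (c := N) hk2.aestronglyMeasurable
      (Filter.Eventually.of_forall fun p => ?_)
    show ‖if p.1 < p.2 then k x p.1 else 0‖ ≤ N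
    split_ifs
    · exact hN _ _
    · simpa using hN0
  refine ⟨I1.integral_prod_left, ?_⟩
  have e1 := integral_integral_swap (f := fun u v => k u v * f v) I1
  have e2 := integral_integral_swap (f := fun u v => k2 u v * f v) I2
  have e3 : (∫ t in Ioo (0:ℝ) l, k x t * ∫ v in Ioo t l, f v)
      = ∫ t in Ioo (0:ℝ) l, ∫ v in Ioo (0:ℝ) l, k2 t v * f v := by
    refine setIntegral_congr_fun measurableSet_Ioo fun t ht => ?_
    have : Ioo t l = Ioo 0 l ∩ Ioi t := by
      ext y; simp only [mem_Ioo, mem_inter_iff, mem_Ioi]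
      constructor
      · rintro ⟨h1, h2⟩; exact ⟨⟨ht.1.trans h1, h2⟩, h1⟩
      · rintro ⟨⟨_, h2⟩, h1⟩; exact ⟨h1, h2⟩
    beta_reduce
    rw [this, ← setIntegral_indicator measurableSet_Ioi, ← integral_const_mul]
    congr 1; ext v
    simp only [k2, indicator, mem_Ioi]
    split_ifs <;> simp
  rw [e3, e1, e2, ← integral_add I1.integral_prod_right I2.integral_prod_right]
  refine setIntegral_congr_fun measurableSet_Ioo fun v hv => ?_
  dsimp only
  rw [integral_mul_const, integral_mul_const, add_mul,
    intervalIntegral.integral_of_le hx.1.le, intervalIntegral.integral_of_le hv.1.le,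
    integral_Ioc_eq_integral_Ioo, integral_Ioc_eq_integral_Ioo]
  congr 2
  have : Ioo 0 v = Ioo 0 l ∩ Iio v := by
    ext y; simp only [mem_Ioo, mem_inter_iff, mem_Iio]
    constructor
    · rintro ⟨h1, h2⟩; exact ⟨⟨h1, h2.trans hv.2⟩, h2⟩
    · rintro ⟨⟨h1, _⟩, h2⟩; exact ⟨h1, h2⟩
  rw [this, ← setIntegral_indicator measurableSet_Iio]
  congr 1

/-- truncated extended derivative -/
def dG (l : ℝ) (hl : 0 < l) (φ : ℝ → ℂ) (y : ℝ) : ℂ :=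
  if 0 ≤ y then IccExtend hl.le (fun z : Icc (0:ℝ) l => derivWithin φ (Icc 0 l) z) y else 0

section
variable {l : ℝ} (hl : 0 < l) {φ : ℝ → ℂ}

lemma dG_of_neg {y : ℝ} (hy : y < 0) : dG l hl φ y = 0 := if_neg (not_le.2 hy)

lemma dG_of_mem {y : ℝ} (hy : y ∈ Icc 0 l) : dG l hl φ y = derivWithin φ (Icc 0 l) y := by
  unfold dG; rw [if_pos hy.1, IccExtend_of_mem _ _ hy]

lemma dE_cont (hφ : ContDiffOn ℝ 1 φ (Icc (0:ℝ) l)) :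
    Continuous (IccExtend hl.le (fun z : Icc (0:ℝ) l => derivWithin φ (Icc 0 l) z)) := by
  apply Continuous.Icc_extend'
  exact continuousOn_iff_continuous_restrict.1
    (hφ.continuousOn_derivWithin (uniqueDiffOn_Icc hl) le_rfl)

lemma dG_meas (hφ : ContDiffOn ℝ 1 φ (Icc (0:ℝ) l)) : Measurable (dG l hl φ) :=
  Measurable.ite measurableSet_Ici (dE_cont hl hφ).measurable measurable_const

lemma dG_bdd (hφ : ContDiffOn ℝ 1 φ (Icc (0:ℝ) l)) : ∃ M, ∀ y, ‖dG l hl φ y‖ ≤ M := by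
  obtain ⟨M, hM⟩ := isCompact_Icc.exists_bound_of_continuousOn
    (hφ.continuousOn_derivWithin (uniqueDiffOn_Icc hl) le_rfl)
  have h0 := (norm_nonneg _).trans (hM 0 ⟨le_rfl, hl.le⟩)
  refine ⟨M, fun y => ?_⟩
  unfold dG
  split_ifs
  · exact hM _ (projIcc 0 l hl.le y).2
  · simpa using h0

lemma dG_contAt (hφ : ContDiffOn ℝ 1 φ (Icc (0:ℝ) l)) (y : ℝ) (hy : y ≠ 0) :
    ContinuousAt (dG l hl φ) y := by
  rcases lt_or_gt_of_ne hy with h | h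
  · refine (continuousAt_const (y := (0:ℂ))).congr ?_
    filter_upwards [Iio_mem_nhds h] with z hz
    exact (dG_of_neg hl hz).symm
  · refine (dE_cont hl hφ).continuousAt.congr ?_
    filter_upwards [Ioi_mem_nhds h] with z hz
    exact (if_pos (le_of_lt hz)).symm

lemma dP_dG (hφ : ContDiffOn ℝ 1 φ (Icc (0:ℝ) l)) {x : ℝ} (hx : x ∈ Icc 0 l) :
    dP (dG l hl φ) x = φ x - φ 0 := by
  obtain ⟨M, hM⟩ := dG_bdd hl hφ
  unfold dP
  refine intervalIntegral.integral_eq_sub_of_hasDerivAt_of_le hx.1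
    (hφ.continuousOn.mono (Icc_subset_Icc_right hx.2)) (fun t ht => ?_)
    (ii_of_bdd (dG_meas hl hφ) hM _ _)
  have ht' : t ∈ Icc 0 l := ⟨ht.1.le, ht.2.le.trans hx.2⟩
  rw [dG_of_mem hl ht']
  exact ((hφ.differentiableOn one_ne_zero t ht').hasDerivWithinAt).hasDerivAt
    (Icc_mem_nhds ht.1 (ht.2.trans_le hx.2))

lemma kernel_eq {u v : ℝ} (hu : u ∈ Ioo 0 l) (hv : v ∈ Ioo 0 l) (huv : u ≠ v) :
    closeToDisplacementKernel l φ u v = dK (dG l hl φ) (φ 0) l u v := by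
  unfold closeToDisplacementKernel dK
  rw [add_assoc]
  congr 1
  · rw [intervalIntegral.integral_of_le hl.le,
      setIntegral_eq_of_subset_of_forall_diff_eq_zero (s := Ioc 0 (min u v)) measurableSet_Ioc
        (Ioc_subset_Ioc_right ((min_le_left _ _).trans hu.2.le)),
      integral_Ioc_eq_integral_Ioo]
    · refine setIntegral_congr_fun measurableSet_Ioo fun ζ hζ => ?_
      have h1 := hζ.2.trans_le (min_le_left _ _)
      have h2 := hζ.2.trans_le (min_le_right _ _)
      have := hζ.1
      beta_reduce
      rw [dG_of_mem hl ⟨by linarith, by linarith [hu.2]⟩,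
        dG_of_mem hl ⟨by linarith, by linarith [hv.2]⟩]
    · intro ζ hζ
      have : min u v < ζ := by
        by_contra h
        exact hζ.2 ⟨hζ.1.1, not_lt.1 h⟩
      rcases min_lt_iff.1 this with h | h
      · rw [dG_of_neg hl (show u - ζ < 0 by linarith), zero_mul]
      · rw [dG_of_neg hl (show v - ζ < 0 by linarith), map_zero, mul_zero]
  · rcases lt_or_gt_of_ne huv with h | h
    · rw [if_neg (not_lt.2 h.le), if_pos h, dG_of_neg hl (show u - v < 0 by linarith),
        dG_of_mem hl ⟨by linarith, by linarith [hu.1, hv.2]⟩]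
      simp
    · rw [if_pos h, dG_of_neg hl (show v - u < 0 by linarith),
        dG_of_mem hl ⟨by linarith, by linarith [hv.1, hu.2]⟩]
      simp

lemma kernel_int_eq {u : ℝ} (hu : u ∈ Ioo 0 l) {h1 h2 : ℝ → ℂ}
    (h : h1 =ᵐ[volume.restrict (Ioo 0 l)] h2) :
    ∫ t in Ioo 0 l, closeToDisplacementKernel l φ u t * h1 t
      = ∫ t in Ioo 0 l, dK (dG l hl φ) (φ 0) l u t * h2 t := by
  apply integral_congr_ae
  have hne : ∀ᵐ t ∂(volume.restrict (Ioo (0:ℝ) l)), t ≠ u :=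
    ae_restrict_of_ae (by simp [ae_iff])
  filter_upwards [h, hne, ae_restrict_mem measurableSet_Ioo] with t e1 e2 e3
  rw [e1, kernel_eq hl hu e3 e2.symm]

end

/-- the operator `(Sf)(x) = (1 - |φ(0)|²) f(x) - ∫₀ˡ s(x,t) f(t) dt`
satisfies the operator identity `A S - S A* = i (Φ₁ Φ₁* - Φ₂ Φ₂*)`, where
`Φ₁Φ₁* : f ↦ φ(x) ∫₀ˡ conj(φ(t)) f(t) dt` and `Φ₂Φ₂* : f ↦ ∫₀ˡ f(t) dt`. -/
theorem close_to_displacement_operator_identity (l : ℝ) (hl : 0 < l) (φ : ℝ → ℂ)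
    (hφ : ContDiffOn ℝ 1 φ (Icc (0:ℝ) l))
    (A Astar S : Lp ℂ 2 (volume.restrict (Ioo (0:ℝ) l)) →L[ℂ] Lp ℂ 2 (volume.restrict (Ioo (0:ℝ) l)))
    (hA : ∀ f : Lp ℂ 2 (volume.restrict (Ioo (0:ℝ) l)),
      ⇑(A f) =ᵐ[volume.restrict (Ioo (0:ℝ) l)]
        fun x => -Complex.I * ∫ t in Ioo (0:ℝ) x, f t)
    (hAstar : ∀ f : Lp ℂ 2 (volume.restrict (Ioo (0:ℝ) l)),
      ⇑(Astar f) =ᵐ[volume.restrict (Ioo (0:ℝ) l)]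
        fun x => Complex.I * ∫ t in Ioo x l, f t)
    (hS : ∀ f : Lp ℂ 2 (volume.restrict (Ioo (0:ℝ) l)),
      ⇑(S f) =ᵐ[volume.restrict (Ioo (0:ℝ) l)]
        fun x => ((1 : ℂ) - (‖φ 0‖ : ℂ)^2) * f x -
          ∫ t in Ioo (0:ℝ) l, closeToDisplacementKernel l φ x t * f t) :
    ∀ f : Lp ℂ 2 (volume.restrict (Ioo (0:ℝ) l)),
      ⇑(A (S f) - S (Astar f)) =ᵐ[volume.restrict (Ioo (0:ℝ) l)]
        fun x => Complex.I *
          ((φ x * ∫ t in Ioo (0:ℝ) l, (starRingEnd ℂ) (φ t) * f t) -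
            ∫ t in Ioo (0:ℝ) l, f t) := by
  intro f
  obtain ⟨M, hM⟩ := dG_bdd hl hφ
  have hm := dG_meas hl hφ
  set c : ℂ := (1 : ℂ) - (‖φ 0‖ : ℂ)^2 with hc
  have hf : Integrable f (volume.restrict (Ioo (0:ℝ) l)) :=
    (Lp.memLp f).integrable (by norm_num)
  filter_upwards [hA (S f), hS (Astar f), hAstar f, Lp.coeFn_sub (A (S f)) (S (Astar f)),
    ae_restrict_mem measurableSet_Ioo] with x eA eS eAs eSub hx
  obtain ⟨J, E⟩ := op_swap (dK_meas hm (φ 0) l) (dK_bdd hM (φ 0) l) hx hf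
  have hsub : Ioo 0 x ⊆ Ioo 0 l := Ioo_subset_Ioo_right hx.2.le
  have hf1 : IntegrableOn f (Ioo 0 x) := IntegrableOn.mono_set hf hsub
  have hf2 : IntegrableOn f (Ioo x l) :=
    IntegrableOn.mono_set hf (Ioo_subset_Ioo_left hx.1.le)
  -- A S f
  have t1 : ∫ t in Ioo 0 x, (S f) t = c * (∫ t in Ioo 0 x, f t) -
      ∫ u in Ioo 0 x, ∫ v in Ioo 0 l, dK (dG l hl φ) (φ 0) l u v * f v := by
    rw [← integral_const_mul, ← integral_sub (hf1.const_mul c) J]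
    apply integral_congr_ae
    filter_upwards [ae_restrict_of_ae_restrict_of_subset hsub (hS f),
      ae_restrict_mem measurableSet_Ioo] with u e1 e2
    rw [e1, kernel_int_eq hl (hsub e2) Filter.EventuallyEq.rfl]
  have t2 : ∫ t in Ioo 0 l, closeToDisplacementKernel l φ x t * (Astar f) t =
      Complex.I * ∫ t in Ioo 0 l, dK (dG l hl φ) (φ 0) l x t * ∫ v in Ioo t l, f v := by
    rw [kernel_int_eq hl hx (hAstar f), ← integral_const_mul]
    congr 1; ext t; ring
  have t3 : ∫ t in Ioo 0 l, f t = (∫ t in Ioo 0 x, f t) + ∫ t in Ioo x l, f t := by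
    rw [← integral_Ioc_eq_integral_Ioo (x := (0:ℝ)) (y := x),
      ← setIntegral_union _ measurableSet_Ioo _ hf2, Ioc_union_Ioo_eq_Ioo hx.1.le hx.2]
    · exact Set.disjoint_left.2 fun y h1 h2 => not_lt.2 h1.2 h2.1
    · exact IntegrableOn.mono_set hf (fun y hy => ⟨hy.1, hy.2.trans_lt hx.2⟩)
  have hcf : Integrable (fun t => (starRingEnd ℂ) (φ t) * f t) (volume.restrict (Ioo (0:ℝ) l)) := by
    obtain ⟨C, hC⟩ := isCompact_Icc.exists_bound_of_continuousOn hφ.continuousOn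
    refine hf.bdd_mul (c := C) ?_ ?_
    · exact (Complex.continuous_conj.comp_continuousOn
        (hφ.continuousOn.mono Ioo_subset_Icc_self)).aestronglyMeasurable measurableSet_Ioo
    · filter_upwards [ae_restrict_mem measurableSet_Ioo] with t ht
      rw [RCLike.norm_conj]
      exact hC t (Ioo_subset_Icc_self ht)
  have t4 : ∫ v in Ioo 0 l, ((∫ u in (0:ℝ)..x, dK (dG l hl φ) (φ 0) l u v) +
      ∫ t in (0:ℝ)..v, dK (dG l hl φ) (φ 0) l x t) * f v
      = φ x * (∫ t in Ioo 0 l, (starRingEnd ℂ) (φ t) * f t)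
        - (‖φ 0‖ : ℂ)^2 * ∫ t in Ioo 0 l, f t := by
    rw [← integral_const_mul, ← integral_const_mul,
      ← integral_sub (hcf.const_mul _) (hf.const_mul _)]
    refine setIntegral_congr_fun measurableSet_Ioo fun v hv => ?_
    beta_reduce
    rw [dK_identity hm hM (fun y hy => dG_of_neg hl hy) (dG_contAt hl hφ) (φ 0) hx.1.le hv.1.le
      hx.2.le, dP_dG hl hφ (Ioo_subset_Icc_self hx), dP_dG hl hφ (Ioo_subset_Icc_self hv),
      ← Complex.mul_conj', map_sub]
    ring
  rw [eSub, Pi.sub_apply, eA, eS, eAs, t1, t2]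
  rw [t4] at E
  linear_combination Complex.I * E + Complex.I * c * t3 - Complex.I * (∫ t in Ioo 0 l, f t) * hc
end
end

section
/- The zero operator is the unique bounded operator S on L²(0,l) satisfying A S - S A* = 0, where (Af)(x) = -i ∫₀ˣ f(t) dt. That is, if S ∈ B(L²(0,l)) commutes with A in the sense A S = S A*, then S = 0. -/
open MeasureTheory Set

noncomputable section


lemma res_bound {H : Type*} [NormedAddCommGroup H] [InnerProductSpace ℂ H]
    (V : H →L[ℂ] H) (hV : ∀ f, 0 ≤ (inner ℂ (V f) f : ℂ).re) (z : ℂ) (w g : H)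
    (hw : w + z • V w = g) : z.re * ‖V w‖ ≤ ‖g‖ := by
  by_cases h0 : V w = 0
  · simp [h0]
  have hp : 0 < ‖V w‖ := norm_pos_iff.2 h0
  have h1 : (inner ℂ (V w) g : ℂ).re = (inner ℂ (V w) w : ℂ).re + z.re * ‖V w‖ ^ 2 := by
    rw [← hw, inner_add_right, inner_smul_right, inner_self_eq_norm_sq_to_K]
    have : ((‖V w‖ : ℂ)) ^ 2 = ((‖V w‖ ^ 2 : ℝ) : ℂ) := by push_cast; rfl
    simp only [Complex.add_re]
    congr 1
    erw [this, Complex.re_mul_ofReal]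
  have h2 : (inner ℂ (V w) g : ℂ).re ≤ ‖V w‖ * ‖g‖ :=
    (Complex.re_le_norm _).trans (norm_inner_le_norm _ _)
  have h3 := hV w
  have : ‖V w‖ * (z.re * ‖V w‖) ≤ ‖V w‖ * ‖g‖ := by nlinarith
  exact le_of_mul_le_mul_left this hp

lemma abstract_uniq {H : Type*} [NormedAddCommGroup H] [InnerProductSpace ℂ H] [CompleteSpace H]
    (V W S : H →L[ℂ] H) (hV : ∀ f, 0 ≤ (inner ℂ (V f) f : ℂ).re)
    (hW : ∀ f, 0 ≤ (inner ℂ (W f) f : ℂ).re)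
    (uV : ∀ z : ℂ, IsUnit (1 + z • V)) (uW : ∀ z : ℂ, IsUnit (1 + z • W))
    (hVS : ∀ f, V (S f) = - S (W f)) (inj : ∀ f, V f = 0 → f = 0) : S = 0 := by
  ext f
  apply inj
  set G : ℂ → H := fun z => V (Ring.inverse (1 + z • V) (S f)) with hG
  have hdiff : Differentiable ℂ G := by
    intro z
    obtain ⟨u, hu⟩ := uV z
    have h1 : DifferentiableAt ℂ (fun z : ℂ => Ring.inverse (1 + z • V)) z := by
      have := differentiableAt_inverse (𝕜 := ℂ) (uV z)
      exact DifferentiableAt.comp z (f := fun z : ℂ => 1 + z • V) this (by fun_prop)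
    exact V.differentiableAt.comp z (h1.clm_apply (differentiableAt_const _))
  have key : ∀ z w, w + z • V w = S f → G z = V w := by
    intro z w hw
    have : (1 + z • V) w = S f := by simpa using hw
    simp only [hG]
    congr 1
    rw [← this, ← mul_apply_eq_comp, Ring.inverse_mul_cancel _ (uV z)]
    simp
  have hb : ∀ z, |z.re| * ‖G z‖ ≤ ‖S f‖ + ‖S‖ * ‖f‖ := by
    intro z
    rcases le_total 0 z.re with h | h
    · set w := Ring.inverse (1 + z • V) (S f) with hw
      have h1 : w + z • V w = S f := by
        have : (1 + z • V) w = S f := by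
          rw [hw, ← mul_apply_eq_comp, Ring.mul_inverse_cancel _ (uV z)]; simp
        simpa using this
      have h2 := res_bound V hV z w _ h1
      rw [abs_of_nonneg h, key z w h1]
      have : 0 ≤ ‖S‖ * ‖f‖ := by positivity
      linarith
    · set w := Ring.inverse (1 + (-z) • W) f with hw
      have h1 : w + (-z) • W w = f := by
        have : (1 + (-z) • W) w = f := by
          rw [hw, ← mul_apply_eq_comp, Ring.mul_inverse_cancel _ (uW _)]; simp
        simpa using this
      have h2 := res_bound W hW (-z) w _ h1
      have h3 : S w + z • V (S w) = S f := by
        rw [← h1, hVS]; simp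
      rw [abs_of_nonpos h, key z _ h3, hVS, norm_neg]
      have h4 := S.le_opNorm (W w)
      have h5 : -z.re * ‖S (W w)‖ ≤ -z.re * (‖S‖ * ‖W w‖) :=
        mul_le_mul_of_nonneg_left h4 (by linarith)
      have h6 : ‖S‖ * ((-z).re * ‖W w‖) ≤ ‖S‖ * ‖f‖ :=
        mul_le_mul_of_nonneg_left h2 (norm_nonneg _)
      simp only [Complex.neg_re] at h6
      have := norm_nonneg (S f)
      nlinarith
  set C := ‖S f‖ + ‖S‖ * ‖f‖
  have hR : ∀ R : ℝ, 0 < R → R * ‖G 0‖ ≤ 2 * C := by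
    intro R hR
    have hm := Complex.norm_le_of_forall_mem_frontier_norm_le (U := Metric.ball (0:ℂ) R)
      Metric.isBounded_ball (f := fun z => (z ^ 2 + (R:ℂ) ^ 2) • G z) (C := 2 * R * C)
      (Differentiable.diffContOnCl (by fun_prop)) (by
        intro z hz
        rw [frontier_ball _ hR.ne'] at hz
        have hz : ‖z‖ = R := by simpa using hz
        have h2 : z ^ 2 + (R:ℂ) ^ 2 = z * (2 * z.re : ℝ) := by
          rw [← hz, ← Complex.mul_conj', sq, ← mul_add, Complex.add_conj]
        rw [norm_smul, h2, norm_mul, hz, Complex.norm_real, Real.norm_eq_abs, abs_mul, abs_two]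
        have := mul_le_mul_of_nonneg_left (hb z) hR.le
        nlinarith) (z := 0) (subset_closure (Metric.mem_ball_self hR))
    rw [norm_smul] at hm
    simp only [ne_eq, OfNat.ofNat_ne_zero, not_false_eq_true, zero_pow, zero_add, norm_pow, Complex.norm_real, Real.norm_eq_abs, abs_of_pos hR] at hm
    have : R * (R * ‖G 0‖) ≤ R * (2 * C) := by nlinarith
    exact le_of_mul_le_mul_left this hR
  have hG0 : G 0 = V (S f) := key 0 _ (by simp)
  rw [← hG0, ← norm_eq_zero]
  by_contra hne
  have hpos : 0 < ‖G 0‖ := lt_of_le_of_ne (norm_nonneg _) (Ne.symm hne)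
  have hC : 0 ≤ C := by positivity
  have := hR ((2 * C + 1) / ‖G 0‖) (by positivity)
  rw [div_mul_cancel₀ _ hne] at this
  linarith

lemma unit_of_bound {H : Type*} [NormedAddCommGroup H] [NormedSpace ℂ H] [CompleteSpace H]
    (V : H →L[ℂ] H) (K l : ℝ) (h : ∀ n : ℕ, ‖V ^ (n+1)‖ ≤ K * (l ^ n / n.factorial)) (z : ℂ) :
    IsUnit (1 + z • V) := by
  have ht : Filter.Tendsto (fun n : ℕ => (‖z‖ * K) * ((‖z‖ * l) ^ n / n.factorial)) Filter.atTop
      (nhds 0) := by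
    simpa using (FloorSemiring.tendsto_pow_div_factorial_atTop (‖z‖ * l)).const_mul (‖z‖ * K)
  obtain ⟨n, hn⟩ := (ht.eventually (gt_mem_nhds one_pos)).exists
  set x := (-z) • V with hx
  have hlt : ‖x ^ (n+1)‖ < 1 := by
    refine lt_of_le_of_lt ?_ hn
    rw [hx, smul_pow, norm_smul, norm_pow, norm_neg]
    calc _ ≤ ‖z‖ ^ (n+1) * (K * (l ^ n / n.factorial)) := by gcongr; exact h n
      _ = _ := by rw [mul_pow]; ring
  have hu := isUnit_one_sub_of_norm_lt_one hlt
  rw [← mul_neg_geom_sum x (n+1)] at hu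
  have hc : Commute (1 - x) (∑ i ∈ Finset.range (n+1), x ^ i) := by
    rw [Commute, SemiconjBy, mul_neg_geom_sum, geom_sum_mul_neg]
  have := (hc.isUnit_mul_iff.1 hu).1
  convert this using 1
  simp [hx]

lemma setInt_left (l : ℝ) (f : ℝ → ℂ) (x : ℝ) (hx : x ∈ Ioo (0:ℝ) l) :
    ∫ t in Ioo (0:ℝ) x, f t = ∫ t, (if t < x then f t else 0) ∂(volume.restrict (Ioo (0:ℝ) l)) := by
  have h1 : (fun t => if t < x then f t else 0) = (Iio x).indicator f := by
    ext t; simp [indicator]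
  rw [h1, integral_indicator measurableSet_Iio, Measure.restrict_restrict measurableSet_Iio]
  congr 2
  ext t; simp only [mem_inter_iff, mem_Iio, mem_Ioo] at *
  constructor
  · rintro ⟨a, b⟩; exact ⟨b, a, b.trans hx.2⟩
  · rintro ⟨a, b, c⟩; exact ⟨b, a⟩

lemma setInt_right (l : ℝ) (f : ℝ → ℂ) (x : ℝ) (hx : x ∈ Ioo (0:ℝ) l) :
    ∫ t in Ioo x l, f t = ∫ t, (if x < t then f t else 0) ∂(volume.restrict (Ioo (0:ℝ) l)) := by
  have h1 : (fun t => if x < t then f t else 0) = (Ioi x).indicator f := by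
    ext t; simp [indicator]
  rw [h1, integral_indicator measurableSet_Ioi, Measure.restrict_restrict measurableSet_Ioi]
  congr 2
  ext t; simp only [mem_inter_iff, mem_Ioi, mem_Ioo] at *
  constructor
  · rintro ⟨a, b⟩; exact ⟨a, hx.1.trans a, b⟩
  · rintro ⟨a, b, c⟩; exact ⟨a, c⟩

lemma lp_int (l : ℝ) (f : Lp ℂ 2 (volume.restrict (Ioo (0:ℝ) l))) :
    Integrable f (volume.restrict (Ioo (0:ℝ) l)) :=
  (Lp.memLp f).integrable (by norm_num)

lemma V_adj (l : ℝ)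
    (V W : Lp ℂ 2 (volume.restrict (Ioo (0:ℝ) l)) →L[ℂ] Lp ℂ 2 (volume.restrict (Ioo (0:ℝ) l)))
    (hV : ∀ f : Lp ℂ 2 (volume.restrict (Ioo (0:ℝ) l)),
      ⇑(V f) =ᵐ[volume.restrict (Ioo (0:ℝ) l)] fun x => ∫ t in Ioo (0:ℝ) x, f t)
    (hW : ∀ f : Lp ℂ 2 (volume.restrict (Ioo (0:ℝ) l)),
      ⇑(W f) =ᵐ[volume.restrict (Ioo (0:ℝ) l)] fun x => ∫ t in Ioo x l, f t)
    (f g : Lp ℂ 2 (volume.restrict (Ioo (0:ℝ) l))) :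
    (inner ℂ (V f) g : ℂ) = inner ℂ f (W g) := by
  have hm : ∀ᵐ x ∂(volume.restrict (Ioo (0:ℝ) l)), x ∈ Ioo (0:ℝ) l := ae_restrict_mem measurableSet_Ioo
  set k : ℝ → ℝ → ℂ := fun x t => if t < x then g x * (starRingEnd ℂ) (f t) else 0 with hk
  have h1 : (inner ℂ (V f) g : ℂ) = ∫ x, ∫ t, k x t ∂(volume.restrict (Ioo (0:ℝ) l)) ∂(volume.restrict (Ioo (0:ℝ) l)) := by
    rw [L2.inner_def]
    apply integral_congr_ae
    filter_upwards [hm, hV f] with x hx hVx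
    rw [hVx, setInt_left l f x hx, RCLike.inner_apply, ← integral_conj, ← integral_const_mul]
    congr 1; ext t; simp only [hk]; split_ifs <;> simp
  have h2 : (inner ℂ f (W g) : ℂ) = ∫ t, ∫ x, k x t ∂(volume.restrict (Ioo (0:ℝ) l)) ∂(volume.restrict (Ioo (0:ℝ) l)) := by
    rw [L2.inner_def]
    apply integral_congr_ae
    filter_upwards [hm, hW g] with x hx hVx
    rw [hVx, setInt_right l g x hx, RCLike.inner_apply, ← integral_mul_const]
    congr 1; ext t; simp only [hk]; split_ifs <;> simp
  rw [h1, h2]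
  apply integral_integral_swap
  have hf : Integrable (fun t => (starRingEnd ℂ) (f t)) (volume.restrict (Ioo (0:ℝ) l)) :=
    (Complex.conjCLE.toContinuousLinearMap.integrable_comp (lp_int l f) :)
  have h3 := (lp_int l g).mul_prod hf
  have hs : MeasurableSet {p : ℝ × ℝ | p.2 < p.1} := measurableSet_lt measurable_snd measurable_fst
  refine (h3.indicator hs).congr (Filter.EventuallyEq.of_eq ?_)
  ext ⟨a, b⟩
  simp [hk, indicator, Function.uncurry]

lemma V_pos (l : ℝ)
    (V W : Lp ℂ 2 (volume.restrict (Ioo (0:ℝ) l)) →L[ℂ] Lp ℂ 2 (volume.restrict (Ioo (0:ℝ) l)))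
    (hV : ∀ f : Lp ℂ 2 (volume.restrict (Ioo (0:ℝ) l)),
      ⇑(V f) =ᵐ[volume.restrict (Ioo (0:ℝ) l)] fun x => ∫ t in Ioo (0:ℝ) x, f t)
    (hW : ∀ f : Lp ℂ 2 (volume.restrict (Ioo (0:ℝ) l)),
      ⇑(W f) =ᵐ[volume.restrict (Ioo (0:ℝ) l)] fun x => ∫ t in Ioo x l, f t)
    (f : Lp ℂ 2 (volume.restrict (Ioo (0:ℝ) l))) :
    0 ≤ (inner ℂ (V f) f : ℂ).re ∧ 0 ≤ (inner ℂ (W f) f : ℂ).re := by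
  have hadj := V_adj l V W hV hW f f
  have hre : (inner ℂ (W f) f : ℂ).re = (inner ℂ (V f) f : ℂ).re := by
    rw [hadj, ← inner_conj_symm, Complex.conj_re]
  have hsum : (inner ℂ (V f) f : ℂ) + inner ℂ (W f) f =
      (∫ t in Ioo (0:ℝ) l, f t) * (starRingEnd ℂ) (∫ t in Ioo (0:ℝ) l, f t) := by
    rw [← inner_add_left, L2.inner_def, ← integral_mul_const]
    apply integral_congr_ae
    have hm : ∀ᵐ x ∂(volume.restrict (Ioo (0:ℝ) l)), x ∈ Ioo (0:ℝ) l :=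
      ae_restrict_mem measurableSet_Ioo
    filter_upwards [hm, hV f, hW f, Lp.coeFn_add (V f) (W f)] with x hx h1 h2 h3
    rw [RCLike.inner_apply, h3, Pi.add_apply, h1, h2]
    congr 2
    have hi : IntegrableOn f (Ioo 0 l) := lp_int l f
    have hi1 : IntegrableOn f (Ioo 0 x) := hi.mono_set (Ioo_subset_Ioo_right hx.2.le)
    have hi2 : IntegrableOn f (Ioo x l) := hi.mono_set (Ioo_subset_Ioo_left hx.1.le)
    rw [← integral_Ioc_eq_integral_Ioo, ← integral_Ioc_eq_integral_Ioo,
      ← integral_Ioc_eq_integral_Ioo, ← intervalIntegral.integral_of_le hx.1.le,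
      ← intervalIntegral.integral_of_le hx.2.le,
      ← intervalIntegral.integral_of_le (hx.1.trans hx.2).le]
    apply intervalIntegral.integral_add_adjacent_intervals
    · rwa [intervalIntegrable_iff_integrableOn_Ioo_of_le hx.1.le]
    · rwa [intervalIntegrable_iff_integrableOn_Ioo_of_le hx.2.le]
  have h := congrArg Complex.re hsum
  rw [Complex.mul_conj, Complex.ofReal_re, Complex.add_re] at h
  have := Complex.normSq_nonneg (∫ t in Ioo (0:ℝ) l, f t)
  constructor <;> linarith

lemma V_inj (l : ℝ) (hl : 0 < l)
    (V : Lp ℂ 2 (volume.restrict (Ioo (0:ℝ) l)) →L[ℂ] Lp ℂ 2 (volume.restrict (Ioo (0:ℝ) l)))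
    (hV : ∀ f : Lp ℂ 2 (volume.restrict (Ioo (0:ℝ) l)),
      ⇑(V f) =ᵐ[volume.restrict (Ioo (0:ℝ) l)] fun x => ∫ t in Ioo (0:ℝ) x, f t)
    (f : Lp ℂ 2 (volume.restrict (Ioo (0:ℝ) l))) (hf : V f = 0) : f = 0 := by
  have hi : IntegrableOn f (Ioo 0 l) := lp_int l f
  have hii : IntervalIntegrable f volume 0 l := by
    rwa [intervalIntegrable_iff_integrableOn_Ioo_of_le hl.le]
  have h0 := hV f
  rw [hf] at h0
  have hcont : ContinuousOn (fun x => ∫ t in (0:ℝ)..x, f t) (Ioo 0 l) := by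
    have := intervalIntegral.continuousOn_primitive_interval' hii (left_mem_uIcc)
    rw [uIcc_of_le hl.le] at this
    exact this.mono Ioo_subset_Icc_self
  have hz : EqOn (fun x => ∫ t in (0:ℝ)..x, f t) (fun _ => 0) (Ioo 0 l) := by
    apply Measure.eqOn_open_of_ae_eq (μ := volume) _ isOpen_Ioo hcont continuousOn_const
    filter_upwards [h0, Lp.coeFn_zero ℂ 2 (volume.restrict (Ioo (0:ℝ) l)),
      ae_restrict_mem measurableSet_Ioo] with x h1 h2 h3
    rw [intervalIntegral.integral_of_le h3.1.le, integral_Ioc_eq_integral_Ioo, ← h1, h2]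
    rfl
  rw [Lp.eq_zero_iff_ae_eq_zero]
  have hd := ae_restrict_of_ae (s := Ioo (0:ℝ) l) hii.ae_hasDerivAt_integral
  filter_upwards [hd, ae_restrict_mem measurableSet_Ioo] with x hx hxm
  have h1 := hx (by rw [uIcc_of_le hl.le]; exact Ioo_subset_Icc_self hxm) 0 left_mem_uIcc
  have h2 : HasDerivAt (fun x => ∫ t in (0:ℝ)..x, f t) 0 x :=
    (hasDerivAt_const x (0:ℂ)).congr_of_eventuallyEq
      (hz.eventuallyEq_of_mem (isOpen_Ioo.mem_nhds hxm))
  exact h1.unique h2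

lemma L1_bound (l : ℝ) : ∃ K : ℝ, 0 ≤ K ∧ ∀ f : Lp ℂ 2 (volume.restrict (Ioo (0:ℝ) l)),
    ∫ t, ‖f t‖ ∂(volume.restrict (Ioo (0:ℝ) l)) ≤ K * ‖f‖ := by
  set μ := volume.restrict (Ioo (0:ℝ) l)
  refine ⟨(μ univ ^ (1 / (1:ENNReal).toReal - 1 / (2:ENNReal).toReal)).toReal,
    ENNReal.toReal_nonneg, fun f => ?_⟩
  have h := eLpNorm_le_eLpNorm_mul_rpow_measure_univ (p := 1) (q := 2) (by norm_num)
    (Lp.aestronglyMeasurable f)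
  rw [integral_norm_eq_lintegral_enorm (Lp.aestronglyMeasurable f), ← eLpNorm_one_eq_lintegral_enorm,
    Lp.norm_def, mul_comm, ← ENNReal.toReal_mul]
  apply ENNReal.toReal_mono _ h
  apply ENNReal.mul_ne_top (Lp.eLpNorm_ne_top f)
  apply ENNReal.rpow_ne_top_of_nonneg (by norm_num)
  exact measure_ne_top μ _

lemma V_pow (l : ℝ)
    (V : Lp ℂ 2 (volume.restrict (Ioo (0:ℝ) l)) →L[ℂ] Lp ℂ 2 (volume.restrict (Ioo (0:ℝ) l)))
    (hV : ∀ f : Lp ℂ 2 (volume.restrict (Ioo (0:ℝ) l)),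
      ⇑(V f) =ᵐ[volume.restrict (Ioo (0:ℝ) l)] fun x => ∫ t in Ioo (0:ℝ) x, f t)
    (f : Lp ℂ 2 (volume.restrict (Ioo (0:ℝ) l))) (n : ℕ) :
    ∀ᵐ x ∂(volume.restrict (Ioo (0:ℝ) l)), ‖(V ^ (n+1)) f x‖ ≤
      (∫ t, ‖f t‖ ∂(volume.restrict (Ioo (0:ℝ) l))) * (x ^ n / n.factorial) := by
  have hm : ∀ᵐ x ∂(volume.restrict (Ioo (0:ℝ) l)), x ∈ Ioo (0:ℝ) l :=
      ae_restrict_mem measurableSet_Ioo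
  set c := ∫ t, ‖f t‖ ∂(volume.restrict (Ioo (0:ℝ) l)) with hc
  induction n with
  | zero =>
    filter_upwards [hm, hV f] with x hx h1
    simp only [zero_add, pow_one, h1, pow_zero, Nat.factorial_zero, Nat.cast_one, div_one, mul_one]
    refine (norm_integral_le_integral_norm _).trans ?_
    exact setIntegral_mono_set (lp_int l f).norm (Filter.Eventually.of_forall fun _ => norm_nonneg _)
      (Ioo_subset_Ioo_right hx.2.le).eventuallyLE
  | succ n ih =>
    filter_upwards [hm, hV ((V ^ (n+1)) f)] with x hx h1
    rw [pow_succ', mul_apply_eq_comp, h1]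
    have hsub : Ioo 0 x ⊆ Ioo 0 l := Ioo_subset_Ioo_right hx.2.le
    have ih' := ae_restrict_of_ae_restrict_of_subset hsub ih
    have hci : IntervalIntegrable (fun t : ℝ => c * (t ^ n / n.factorial)) volume 0 x := by
      apply Continuous.intervalIntegrable; fun_prop
    rw [intervalIntegrable_iff_integrableOn_Ioo_of_le hx.1.le] at hci
    refine (norm_integral_le_of_norm_le hci ih').trans (le_of_eq ?_)
    rw [← integral_Ioc_eq_integral_Ioo, ← intervalIntegral.integral_of_le hx.1.le,
      intervalIntegral.integral_const_mul, intervalIntegral.integral_div, integral_pow,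
      Nat.factorial_succ]
    push_cast
    have : (n.factorial : ℝ) ≠ 0 := by positivity
    have : (n + 1 : ℝ) ≠ 0 := by positivity
    field_simp
    simp

lemma V_unit (l : ℝ)
    (V : Lp ℂ 2 (volume.restrict (Ioo (0:ℝ) l)) →L[ℂ] Lp ℂ 2 (volume.restrict (Ioo (0:ℝ) l)))
    (hV : ∀ f : Lp ℂ 2 (volume.restrict (Ioo (0:ℝ) l)),
      ⇑(V f) =ᵐ[volume.restrict (Ioo (0:ℝ) l)] fun x => ∫ t in Ioo (0:ℝ) x, f t)
    (hl : 0 < l) (z : ℂ) : IsUnit (1 + z • V) := by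
  obtain ⟨K, hK, hKf⟩ := L1_bound l
  set M : ℝ := (measureUnivNNReal (volume.restrict (Ioo (0:ℝ) l)) : ℝ) ^ ((2:ENNReal).toReal)⁻¹
    with hM
  have hM0 : 0 ≤ M := by positivity
  refine unit_of_bound V (M * K) l (fun n => ?_) z
  refine ContinuousLinearMap.opNorm_le_bound _ (by positivity) (fun f => ?_)
  have hc : 0 ≤ ∫ t, ‖f t‖ ∂(volume.restrict (Ioo (0:ℝ) l)) := integral_nonneg fun _ => norm_nonneg _
  have h := Lp.norm_le_of_ae_bound (f := (V ^ (n+1)) f)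
    (C := K * ‖f‖ * (l ^ n / n.factorial)) (by positivity) (by
      filter_upwards [V_pow l V hV f n, ae_restrict_mem measurableSet_Ioo] with x hx hxm
      refine hx.trans ?_
      have := hxm.1.le
      have := hxm.2.le
      gcongr
      exact hKf f)
  calc _ ≤ _ := h
    _ = _ := by simp only [hM, NNReal.coe_rpow]; ring

/-- Corollary on uniqueness: `S = 0` is the unique bounded operator
on `L²(0,l)` with `A S - S A* = 0`, i.e. `A S = S A*` implies `S = 0`. -/
theorem unique_solution_of_homogeneous_identity (l : ℝ) (hl : 0 < l)
    (A Astar S : Lp ℂ 2 (volume.restrict (Ioo (0:ℝ) l)) →L[ℂ] Lp ℂ 2 (volume.restrict (Ioo (0:ℝ) l)))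
    (hA : ∀ f : Lp ℂ 2 (volume.restrict (Ioo (0:ℝ) l)),
      ⇑(A f) =ᵐ[volume.restrict (Ioo (0:ℝ) l)]
        fun x => -Complex.I * ∫ t in Ioo (0:ℝ) x, f t)
    (hAstar : ∀ f : Lp ℂ 2 (volume.restrict (Ioo (0:ℝ) l)),
      ⇑(Astar f) =ᵐ[volume.restrict (Ioo (0:ℝ) l)]
        fun x => Complex.I * ∫ t in Ioo x l, f t)
    (hid : ∀ f : Lp ℂ 2 (volume.restrict (Ioo (0:ℝ) l)), A (S f) = S (Astar f)) :
    S = 0 := by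
  set V := Complex.I • A with hVd
  set W := (-Complex.I) • Astar with hWd
  have hV : ∀ f : Lp ℂ 2 (volume.restrict (Ioo (0:ℝ) l)),
      ⇑(V f) =ᵐ[volume.restrict (Ioo (0:ℝ) l)] fun x => ∫ t in Ioo (0:ℝ) x, f t := by
    intro f
    filter_upwards [hA f, Lp.coeFn_smul Complex.I (A f)] with x h1 h2
    rw [hVd, ContinuousLinearMap.smul_apply, h2, Pi.smul_apply, h1, smul_eq_mul, ← mul_assoc]
    simp
  have hW : ∀ f : Lp ℂ 2 (volume.restrict (Ioo (0:ℝ) l)),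
      ⇑(W f) =ᵐ[volume.restrict (Ioo (0:ℝ) l)] fun x => ∫ t in Ioo x l, f t := by
    intro f
    filter_upwards [hAstar f, Lp.coeFn_smul (-Complex.I) (Astar f)] with x h1 h2
    rw [hWd, ContinuousLinearMap.smul_apply, h2, Pi.smul_apply, h1, smul_eq_mul, ← mul_assoc]
    simp
  have hadj : W = star V := by
    rw [ContinuousLinearMap.star_eq_adjoint, ContinuousLinearMap.eq_adjoint_iff]
    intro f g
    rw [← inner_conj_symm, ← V_adj l V W hV hW g f, inner_conj_symm]
  have uV := V_unit l V hV hl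
  refine abstract_uniq V W S (fun f => (V_pos l V W hV hW f).1)
    (fun f => (V_pos l V W hV hW f).2) uV (fun z => ?_) (fun f => ?_) (V_inj l hl V hV)
  · have := (uV (star z)).star
    rw [star_add, star_one, star_smul, star_star, ← hadj] at this
    exact this
  · rw [hVd, hWd]
    simp [hid]
end
end
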